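/- Let n ≥ 1 and let Ω ⊂ ℝⁿ be a nonempty bounded open convex set with smooth boundary. Let F be a Minkowski norm on ℝⁿ and let i_F be the inscribed radius of Ω with respect to the dual norm F⁰. Then for every continuously differentiable function u with compact support contained in Ω, one has ∫_Ω F(∇u(x))² dx ≥ (π²/(4 i_F²)) ∫_Ω u(x)² dx. (Equivalently, the first Dirichlet eigenvalue of the Finsler–Laplacian satisfies λ₁ᴰ ≥ π²/(4 i_F²).) -/

import Mathlib

open Real MeasureTheory
open scoped RealInnerProductSpace

noncomputable section

/-- A Minkowski norm on ℝⁿ: nonnegative, convex, C¹ away from the origin, even,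
positively 1-homogeneous, and positive away from the origin. -/
structure IsMinkowskiNorm {n : ℕ} (F : EuclideanSpace ℝ (Fin n) → ℝ) : Prop where
  nonneg : ∀ ξ, 0 ≤ F ξ
  convexOn : ConvexOn ℝ Set.univ F
  contDiffOn : ContDiffOn ℝ 1 F {(0 : EuclideanSpace ℝ (Fin n))}ᶜ
  even : ∀ ξ, F (-ξ) = F ξ
  homog : ∀ (t : ℝ) (ξ : EuclideanSpace ℝ (Fin n)), F (t • ξ) = |t| * F ξ
  pos : ∀ ξ, ξ ≠ 0 → 0 < F ξ

/-- The dual norm `F⁰(x) = sup_{ξ ≠ 0} ⟨x, ξ⟩ / F(ξ)`. -/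
def dualNorm {n : ℕ} (F : EuclideanSpace ℝ (Fin n) → ℝ)
    (x : EuclideanSpace ℝ (Fin n)) : ℝ :=
  sSup {r : ℝ | ∃ ξ : EuclideanSpace ℝ (Fin n), ξ ≠ 0 ∧ r = ⟪x, ξ⟫ / F ξ}

/-- A set has smooth boundary: near each boundary point there is a smooth local defining
function with nonvanishing differential. -/
def HasSmoothBoundary {n : ℕ} (Ω : Set (EuclideanSpace ℝ (Fin n))) : Prop :=
  ∀ x ∈ frontier Ω, ∃ U ∈ nhds x, ∃ f : EuclideanSpace ℝ (Fin n) → ℝ,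
    ContDiff ℝ (⊤ : ℕ∞) f ∧ (∀ y ∈ U, (y ∈ Ω ↔ f y < 0)) ∧
      ∀ y ∈ U, y ∈ frontier Ω → fderiv ℝ f y ≠ 0

/-- The inscribed radius of `Ω` with respect to `F⁰`: the supremum of radii of
Wulff balls `{x : F⁰(x - x₀) ≤ r}` contained in the closure of `Ω`. -/
def inscribedRadius {n : ℕ} (F : EuclideanSpace ℝ (Fin n) → ℝ)
    (Ω : Set (EuclideanSpace ℝ (Fin n))) : ℝ :=
  sSup {r : ℝ | 0 ≤ r ∧ ∃ x₀ : EuclideanSpace ℝ (Fin n),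
    {x : EuclideanSpace ℝ (Fin n) | dualNorm F (x - x₀) ≤ r} ⊆ closure Ω}

section OneDimensional

/-- Picone's identity for `sin (c (t - α))`, integrated: a Poincaré inequality on `[α, β]` for
functions vanishing near the left endpoint. -/
lemma intervalIntegral_sq_le_of_eqOn_zero {f : ℝ → ℝ} (hf : ContDiff ℝ 1 f) {α β δ c : ℝ}
    (hδ : 0 < δ) (hαβ : α ≤ β) (hc : 0 < c) (hcβ : c * (β - α) ≤ π / 2)
    (hf0 : ∀ t ≤ α + δ, f t = 0) :
    ∫ t in α..β, c ^ 2 * f t ^ 2 ≤ ∫ t in α..β, deriv f t ^ 2 := by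
  have hfc : Continuous f := hf.continuous
  have hdc : Continuous (deriv f) := hf.continuous_deriv le_rfl
  rcases le_or_gt β (α + δ) with hβ | hβ
  · have h0 : ∫ t in α..β, c ^ 2 * f t ^ 2 = ∫ t in α..β, (0 : ℝ) := by
      refine intervalIntegral.integral_congr fun t ht => ?_
      rw [Set.uIcc_of_le hαβ] at ht
      simp [hf0 t (ht.2.trans hβ)]
    rw [h0, intervalIntegral.integral_zero]
    exact intervalIntegral.integral_nonneg hαβ fun t _ => sq_nonneg _
  set γ := α + δ
  have hαγ : α ≤ γ := by simp only [γ]; linarith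
  have int1 : ∀ a b, IntervalIntegrable (fun t => c ^ 2 * f t ^ 2) volume a b := fun a b =>
    (by fun_prop : Continuous fun t => c ^ 2 * f t ^ 2).intervalIntegrable a b
  have int2 : ∀ a b, IntervalIntegrable (fun t => deriv f t ^ 2) volume a b := fun a b =>
    (by fun_prop : Continuous fun t => deriv f t ^ 2).intervalIntegrable a b
  have hsin : ∀ t ∈ Set.Icc γ β, 0 < sin (c * (t - α)) := fun t ht => by
    have h1 : 0 < t - α := by have := ht.1; simp only [γ] at this; linarith
    refine sin_pos_of_pos_of_lt_pi (by positivity) ?_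
    have : c * (t - α) ≤ c * (β - α) := by gcongr; exact ht.2
    linarith [pi_pos]
  have hleft : ∫ t in α..γ, c ^ 2 * f t ^ 2 = ∫ t in α..γ, (0 : ℝ) := by
    refine intervalIntegral.integral_congr fun t ht => ?_
    rw [Set.uIcc_of_le hαγ] at ht
    simp [hf0 t ht.2]
  rw [intervalIntegral.integral_zero] at hleft
  have hleft' : 0 ≤ ∫ t in α..γ, deriv f t ^ 2 :=
    intervalIntegral.integral_nonneg hαγ fun t _ => sq_nonneg _
  rw [← intervalIntegral.integral_add_adjacent_intervals (int1 α γ) (int1 γ β),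
    ← intervalIntegral.integral_add_adjacent_intervals (int2 α γ) (int2 γ β), hleft]
  suffices h : 0 ≤ ∫ t in γ..β, (deriv f t ^ 2 - c ^ 2 * f t ^ 2) by
    rw [intervalIntegral.integral_sub (int2 _ _) (int1 _ _)] at h
    linarith
  let G : ℝ → ℝ := fun t => c * f t ^ 2 * (cos (c * (t - α)) / sin (c * (t - α)))
  let G' : ℝ → ℝ := fun t => c * (2 * f t * deriv f t) * (cos (c * (t - α)) / sin (c * (t - α))) -
    c ^ 2 * f t ^ 2 / sin (c * (t - α)) ^ 2
  have hG : ∀ t ∈ Set.uIcc γ β, HasDerivAt G (G' t) t := fun t ht => by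
    rw [Set.uIcc_of_le hβ.le] at ht
    have hs := (hsin t ht).ne'
    have hd : HasDerivAt f (deriv f t) t := (hf.differentiable (by norm_num) t).hasDerivAt
    have hl : HasDerivAt (fun t => c * (t - α)) c t := by
      simpa using ((hasDerivAt_id t).sub_const α).const_mul c
    have := ((hd.pow 2).const_mul c).mul (hl.cos.div hl.sin hs)
    refine this.congr_deriv ?_
    simp only [G', Pi.div_apply, Pi.pow_apply]
    have h1 := sin_sq_add_cos_sq (c * (t - α))
    field_simp
    linear_combination (-c * f t ^ 2) * h1
  have hG'c : ContinuousOn G' (Set.uIcc γ β) := by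
    rw [Set.uIcc_of_le hβ.le]
    refine ContinuousOn.sub (ContinuousOn.mul (by fun_prop) (ContinuousOn.div (by fun_prop)
      (by fun_prop) fun t ht => (hsin t ht).ne')) (ContinuousOn.div (by fun_prop) (by fun_prop)
      fun t ht => pow_ne_zero 2 (hsin t ht).ne')
  have hFTC := intervalIntegral.integral_eq_sub_of_hasDerivAt hG hG'c.intervalIntegrable
  have hGγ : G γ = 0 := by simp [G, hf0 γ le_rfl]
  have hGβ : 0 ≤ G β := by
    have h1 := hsin β ⟨hβ.le, le_rfl⟩
    have h2 : 0 ≤ cos (c * (β - α)) := by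
      refine cos_nonneg_of_mem_Icc ⟨?_, hcβ⟩
      have : 0 ≤ c * (β - α) := mul_nonneg hc.le (by linarith)
      linarith [pi_pos]
    positivity
  calc 0 ≤ ∫ t in γ..β, G' t := by rw [hFTC, hGγ]; linarith
    _ ≤ _ := by
      refine intervalIntegral.integral_mono_on hβ.le hG'c.intervalIntegrable
        ((int2 _ _).sub (int1 _ _)) fun t ht => ?_
      have hs := (hsin t ht).ne'
      have h1 := sin_sq_add_cos_sq (c * (t - α))
      have h2 : deriv f t ^ 2 - c ^ 2 * f t ^ 2 - G' t =
          (deriv f t - c * f t * (cos (c * (t - α)) / sin (c * (t - α)))) ^ 2 := by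
        simp only [G']
        field_simp
        linear_combination (-c ^ 2 * f t ^ 2) * h1
      linarith [sq_nonneg (deriv f t - c * f t * (cos (c * (t - α)) / sin (c * (t - α))))]

/-- The one-dimensional Poincaré inequality on an initial segment `S` of `(α, α + R]`. -/
lemma setLIntegral_sq_le_of_initialSegment {f : ℝ → ℝ} (hf : ContDiff ℝ 1 f) {α δ R : ℝ}
    (hδ : 0 < δ) (hR : 0 < R) (hf0 : ∀ t ≤ α + δ, f t = 0) {S : Set ℝ}
    (hS : S ⊆ Set.Ioc α (α + R)) (hSd : ∀ t ∈ S, Set.Ioc α t ⊆ S) :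
    ∫⁻ t in S, ENNReal.ofReal ((π / (2 * R)) ^ 2 * f t ^ 2) ≤
      ∫⁻ t in S, ENNReal.ofReal (deriv f t ^ 2) := by
  rcases S.eq_empty_or_nonempty with rfl | hne
  · simp
  have hbdd : BddAbove S := ⟨α + R, fun t ht => (hS ht).2⟩
  set β := sSup S
  have hβR : β ≤ α + R := csSup_le hne fun t ht => (hS ht).2
  have hαβ : α ≤ β := by
    obtain ⟨t, ht⟩ := hne
    exact (hS ht).1.le.trans (le_csSup hbdd ht)
  have hSae : S =ᵐ[volume] Set.Ioc α β := by
    refine Filter.EventuallyLE.antisymm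
      (Filter.Eventually.of_forall fun t ht => ⟨(hS ht).1, le_csSup hbdd ht⟩) ?_
    refine Ioo_ae_eq_Ioc.symm.le.trans (Filter.Eventually.of_forall fun t ht => ?_)
    obtain ⟨s, hs, hts⟩ := exists_lt_of_lt_csSup hne ht.2
    exact hSd s hs ⟨ht.1, hts.le⟩
  have hdc : Continuous (deriv f) := hf.continuous_deriv le_rfl
  have hfc : Continuous f := hf.continuous
  rw [setLIntegral_congr hSae, setLIntegral_congr hSae,
    ← ofReal_integral_eq_lintegral_ofReal, ← ofReal_integral_eq_lintegral_ofReal,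
    ← intervalIntegral.integral_of_le hαβ, ← intervalIntegral.integral_of_le hαβ]
  · refine ENNReal.ofReal_le_ofReal
      (intervalIntegral_sq_le_of_eqOn_zero hf hδ hαβ (by positivity) ?_ hf0)
    calc π / (2 * R) * (β - α) ≤ π / (2 * R) * R := by gcongr; linarith
      _ = π / 2 := by field_simp
  · exact (by fun_prop : Continuous fun t => deriv f t ^ 2).integrableOn_Ioc
  · exact Filter.Eventually.of_forall fun t => sq_nonneg _
  · exact (by fun_prop : Continuous fun t => (π / (2 * R)) ^ 2 * f t ^ 2).integrableOn_Ioc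
  · exact Filter.Eventually.of_forall fun t => by positivity

end OneDimensional

section Slicing

variable {E : Type*} [NormedAddCommGroup E] [NormedSpace ℝ E] [FiniteDimensional ℝ E]
  [MeasurableSpace E] [BorelSpace E]

/-- Integration along the lines in direction `w`, parametrized by a slab transverse to `w`. -/
lemma lintegral_eq_lintegral_slab (μ : Measure E) [μ.IsAddHaarMeasure] {g : E → ENNReal}
    (hg : Measurable g) {a : E → ℝ} (ha : Measurable a) {w : E}
    (haw : ∀ x (t : ℝ), a (x + t • w) = a x + t) :
    ∫⁻ x, g x ∂μ = ∫⁻ x in a ⁻¹' Set.Ico 0 1, (∫⁻ t : ℝ, g (x + t • w)) ∂μ := by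
  have hs : MeasurableSet (a ⁻¹' Set.Ico 0 1) := ha measurableSet_Ico
  have hI : Measurable ((a ⁻¹' Set.Ico 0 1).indicator (1 : E → ENNReal)) :=
    measurable_one.indicator hs
  symm
  calc ∫⁻ x in a ⁻¹' Set.Ico 0 1, (∫⁻ t : ℝ, g (x + t • w)) ∂μ
      = ∫⁻ x, (∫⁻ t : ℝ, (a ⁻¹' Set.Ico 0 1).indicator 1 x * g (x + t • w)) ∂μ := by
        rw [← lintegral_indicator hs]
        refine lintegral_congr fun x => ?_
        by_cases hx : x ∈ a ⁻¹' Set.Ico 0 1 <;> simp [hx]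
    _ = ∫⁻ t : ℝ, ∫⁻ x, (a ⁻¹' Set.Ico 0 1).indicator 1 x * g (x + t • w) ∂μ := by
        refine lintegral_lintegral_swap (Measurable.aemeasurable ?_)
        exact (hI.comp measurable_fst).mul (hg.comp (by fun_prop))
    _ = ∫⁻ t : ℝ, ∫⁻ x, (a ⁻¹' Set.Ico 0 1).indicator 1 (x - t • w) * g x ∂μ := by
        refine lintegral_congr fun t => ?_
        rw [← lintegral_add_right_eq_self
          (fun x => (a ⁻¹' Set.Ico 0 1).indicator 1 (x - t • w) * g x) (t • w)]
        simp
    _ = ∫⁻ x, (∫⁻ t : ℝ, (a ⁻¹' Set.Ico 0 1).indicator 1 (x - t • w) * g x) ∂μ := by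
        refine lintegral_lintegral_swap (Measurable.aemeasurable ?_)
        exact (hI.comp (by fun_prop)).mul (hg.comp measurable_snd)
    _ = ∫⁻ x, g x ∂μ := by
        refine lintegral_congr fun x => ?_
        have h1 : ∀ t : ℝ, (a ⁻¹' Set.Ico 0 1).indicator (1 : E → ENNReal) (x - t • w) =
            (Set.Ioc (a x - 1) (a x)).indicator 1 t := fun t => by
          have h2 : a (x - t • w) = a x - t := by
            rw [sub_eq_add_neg, ← neg_smul, haw, sub_eq_add_neg]
          have h3 : x - t • w ∈ a ⁻¹' Set.Ico 0 1 ↔ t ∈ Set.Ioc (a x - 1) (a x) := by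
            rw [Set.mem_preimage, h2, Set.mem_Ico, Set.mem_Ioc]
            constructor <;> rintro ⟨_, _⟩ <;> constructor <;> linarith
          by_cases ht : t ∈ Set.Ioc (a x - 1) (a x)
          · rw [Set.indicator_of_mem ht, Set.indicator_of_mem (h3.2 ht)]
            rfl
          · rw [Set.indicator_of_notMem ht, Set.indicator_of_notMem (h3.not.2 ht)]
        simp_rw [h1]
        rw [lintegral_mul_const _ (measurable_one.indicator measurableSet_Ioc),
          lintegral_indicator_one measurableSet_Ioc]
        simp

/-- A directional Poincaré inequality on a set `D` fibred by segments of length at most `R`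
issuing from the hyperplane `a = 0`. -/
lemma setLIntegral_sq_le_of_fibred (μ : Measure E) [μ.IsAddHaarMeasure] {u : E → ℝ}
    (hu : ContDiff ℝ 1 u) {a : E → ℝ} (ha : Measurable a) {w : E}
    (haw : ∀ x (t : ℝ), a (x + t • w) = a x + t) {δ R : ℝ} (hδ : 0 < δ) (hR : 0 < R)
    (hu0 : ∀ x, a x ≤ δ → u x = 0) {D : Set E} (hD : MeasurableSet D)
    (hDa : ∀ x ∈ D, 0 < a x ∧ a x ≤ R)
    (hDw : ∀ x ∈ D, ∀ t : ℝ, t ≤ 0 → 0 < a x + t → x + t • w ∈ D) :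
    ∫⁻ x in D, ENNReal.ofReal ((π / (2 * R)) ^ 2 * u x ^ 2) ∂μ ≤
      ∫⁻ x in D, ENNReal.ofReal (fderiv ℝ u x w ^ 2) ∂μ := by
  have huc : Continuous u := hu.continuous
  have hdc : Continuous fun x => fderiv ℝ u x w :=
    (hu.continuous_fderiv (by norm_num)).clm_apply continuous_const
  have hm1 : Measurable fun x => ENNReal.ofReal ((π / (2 * R)) ^ 2 * u x ^ 2) :=
    ENNReal.measurable_ofReal.comp
      (by fun_prop : Continuous fun x => (π / (2 * R)) ^ 2 * u x ^ 2).measurable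
  have hm2 : Measurable fun x => ENNReal.ofReal (fderiv ℝ u x w ^ 2) :=
    ENNReal.measurable_ofReal.comp (hdc.pow 2).measurable
  rw [← lintegral_indicator hD, ← lintegral_indicator hD,
    lintegral_eq_lintegral_slab μ (hm1.indicator hD) ha haw,
    lintegral_eq_lintegral_slab μ (hm2.indicator hD) ha haw]
  refine lintegral_mono fun x => ?_
  have hline : Measurable fun t : ℝ => x + t • w := by fun_prop
  have hS : MeasurableSet ((fun t : ℝ => x + t • w) ⁻¹' D) := hline hD
  have hderiv : ∀ t, deriv (fun t : ℝ => u (x + t • w)) t = fderiv ℝ u (x + t • w) w := fun t => by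
    have h1 : HasDerivAt (fun t : ℝ => x + t • w) w t := by
      simpa using ((hasDerivAt_id t).smul_const w).const_add x
    exact ((hu.differentiable (by norm_num) _).hasFDerivAt.comp_hasDerivAt t h1).deriv
  have key := setLIntegral_sq_le_of_initialSegment (f := fun t : ℝ => u (x + t • w))
    (hu.comp (by fun_prop)) (α := -a x) hδ hR
    (fun t ht => hu0 _ (by rw [haw]; linarith))
    (S := (fun t : ℝ => x + t • w) ⁻¹' D)
    (fun t ht => by
      have := hDa _ ht
      rw [haw] at this
      exact ⟨by linarith, by linarith⟩)
    (fun t ht s hs => by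
      have h1 := hDw _ ht (s - t) (by linarith [hs.2]) (by rw [haw]; linarith [hs.1])
      rwa [add_assoc, ← add_smul, add_sub_cancel] at h1)
  simp_rw [hderiv] at key
  rw [← lintegral_indicator hS, ← lintegral_indicator hS] at key
  exact key

end Slicing

section Cells

variable {E : Type*} {N : ℕ}

/-- The part of `{0 < min a ≤ R}` where `a i` is minimal among the `a j`, ties being broken in
favour of the least index. -/
def minCell (a : Fin N → E → ℝ) (R : ℝ) (i : Fin N) : Set E :=
  {x | (0 < a i x ∧ a i x ≤ R) ∧ ∀ j, a i x ≤ a j x ∧ (j < i → a i x < a j x)}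

lemma measurableSet_minCell [MeasurableSpace E] {a : Fin N → E → ℝ}
    (ha : ∀ i, Measurable (a i)) (R : ℝ) (i : Fin N) : MeasurableSet (minCell a R i) := by
  have h1 := fun j => measurableSet_le (ha i) (ha j)
  have h2 := fun j => measurableSet_lt (ha i) (ha j)
  have h3 : minCell a R i = ({x | 0 < a i x} ∩ {x | a i x ≤ R}) ∩
      ⋂ j, {x | a i x ≤ a j x} ∩ ⋂ _ : j < i, {x | a i x < a j x} := by
    ext x
    simp [minCell]
  rw [h3]
  refine ((measurableSet_lt measurable_const (ha i)).inter
    (measurableSet_le (ha i) measurable_const)).inter ?_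
  exact MeasurableSet.iInter fun j => (h1 j).inter (MeasurableSet.iInter fun _ => h2 j)

lemma pairwise_disjoint_minCell (a : Fin N → E → ℝ) (R : ℝ) :
    Pairwise (Function.onFun Disjoint (minCell a R)) := by
  have key : ∀ i j, i < j → ∀ x, x ∈ minCell a R i → x ∉ minCell a R j := fun i j hij x hi hj =>
    absurd ((hj.2 i).2 hij) (not_lt.2 (hi.2 j).1)
  intro i j hij
  refine Set.disjoint_left.2 fun x hi hj => ?_
  rcases lt_or_gt_of_ne hij with h | h
  exacts [key i j h x hi hj, key j i h x hj hi]

lemma exists_mem_minCell {a : Fin N → E → ℝ} {R : ℝ} {x : E} (hpos : ∀ i, 0 < a i x)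
    (hR : ∃ i, a i x ≤ R) : ∃ i, x ∈ minCell a R i := by
  obtain ⟨k, hk⟩ := hR
  have : Nonempty (Fin N) := ⟨k⟩
  obtain ⟨m, hm⟩ := Finite.exists_min fun i => a i x
  obtain ⟨i, hi, himin⟩ := Set.exists_min_image {i | a i x ≤ a m x} id (Set.toFinite _)
    ⟨m, le_refl (a m x)⟩
  refine ⟨i, ⟨hpos i, (hi.trans (hm k)).trans hk⟩, fun j => ⟨hi.trans (hm j), fun hji => ?_⟩⟩
  by_contra h
  exact absurd (himin j ((not_lt.1 h).trans hi)) (not_le.2 hji)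

end Cells

section Minkowski

variable {n : ℕ} {F : EuclideanSpace ℝ (Fin n) → ℝ}

lemma IsMinkowskiNorm.map_zero (hF : IsMinkowskiNorm F) : F 0 = 0 := by
  simpa using hF.homog 0 0

lemma IsMinkowskiNorm.continuous (hF : IsMinkowskiNorm F) : Continuous F :=
  continuousOn_univ.1 (hF.convexOn.continuousOn isOpen_univ)

lemma IsMinkowskiNorm.add_le (hF : IsMinkowskiNorm F) (x y : EuclideanSpace ℝ (Fin n)) :
    F (x + y) ≤ F x + F y := by
  have h := hF.convexOn.2 (Set.mem_univ ((2 : ℝ) • x)) (Set.mem_univ ((2 : ℝ) • y))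
    (by norm_num : (0 : ℝ) ≤ 1 / 2) (by norm_num : (0 : ℝ) ≤ 1 / 2) (by norm_num)
  simp only [smul_smul, hF.homog, smul_eq_mul] at h
  norm_num at h
  linarith

lemma IsMinkowskiNorm.exists_pos_mul_norm_le (hF : IsMinkowskiNorm F) :
    ∃ m > 0, ∀ ξ, m * ‖ξ‖ ≤ F ξ := by
  rcases (Metric.sphere (0 : EuclideanSpace ℝ (Fin n)) 1).eq_empty_or_nonempty with h | h
  · refine ⟨1, one_pos, fun ξ => ?_⟩
    by_cases hξ : ξ = 0
    · simp [hξ, hF.map_zero]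
    · have : ‖ξ‖⁻¹ • ξ ∈ Metric.sphere (0 : EuclideanSpace ℝ (Fin n)) 1 := by
        simp [norm_smul, hξ]
      simp [h] at this
  · obtain ⟨v, hv, hmin⟩ := (isCompact_sphere (0 : EuclideanSpace ℝ (Fin n)) 1).exists_isMinOn h
      hF.continuous.continuousOn
    have hv0 : v ≠ 0 := by rintro rfl; simp at hv
    refine ⟨F v, hF.pos v hv0, fun ξ => ?_⟩
    by_cases hξ : ξ = 0
    · simp [hξ, hF.map_zero]
    have hmem : ‖ξ‖⁻¹ • ξ ∈ Metric.sphere (0 : EuclideanSpace ℝ (Fin n)) 1 := by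
      simp [norm_smul, hξ]
    have h1 : F v ≤ F (‖ξ‖⁻¹ • ξ) := hmin hmem
    have h2 : 0 < ‖ξ‖ := norm_pos_iff.2 hξ
    rw [hF.homog, abs_of_pos (inv_pos.2 h2), inv_mul_eq_div, le_div_iff₀ h2] at h1
    exact h1

lemma inner_div_le_norm_div (hF : IsMinkowskiNorm F) {m : ℝ} (hm : 0 < m)
    (hmF : ∀ ξ, m * ‖ξ‖ ≤ F ξ) (x : EuclideanSpace ℝ (Fin n)) {ξ : EuclideanSpace ℝ (Fin n)}
    (hξ : ξ ≠ 0) : ⟪x, ξ⟫ / F ξ ≤ ‖x‖ / m := by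
  rw [div_le_div_iff₀ (hF.pos ξ hξ) hm]
  calc ⟪x, ξ⟫ * m ≤ ‖x‖ * ‖ξ‖ * m := by gcongr; exact real_inner_le_norm x ξ
    _ = ‖x‖ * (m * ‖ξ‖) := by ring
    _ ≤ ‖x‖ * F ξ := by gcongr; exact hmF ξ

lemma inner_le_dualNorm_mul (hF : IsMinkowskiNorm F) (x ξ : EuclideanSpace ℝ (Fin n)) :
    ⟪x, ξ⟫ ≤ dualNorm F x * F ξ := by
  obtain ⟨m, hm, hmF⟩ := hF.exists_pos_mul_norm_le
  by_cases hξ : ξ = 0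
  · simp [hξ, hF.map_zero]
  rw [← div_le_iff₀ (hF.pos ξ hξ)]
  refine le_csSup ⟨‖x‖ / m, ?_⟩ ⟨ξ, hξ, rfl⟩
  rintro _ ⟨η, hη, rfl⟩
  exact inner_div_le_norm_div hF hm hmF x hη

lemma dualNorm_le_norm_div (hF : IsMinkowskiNorm F) {m : ℝ} (hm : 0 < m)
    (hmF : ∀ ξ, m * ‖ξ‖ ≤ F ξ) (x : EuclideanSpace ℝ (Fin n)) : dualNorm F x ≤ ‖x‖ / m := by
  refine Real.sSup_le ?_ (by positivity)
  rintro _ ⟨η, hη, rfl⟩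
  exact inner_div_le_norm_div hF hm hmF x hη

/-- A subgradient of `F` at `ν`. -/
lemma IsMinkowskiNorm.exists_inner_eq (hF : IsMinkowskiNorm F) {ν : EuclideanSpace ℝ (Fin n)}
    (hν : F ν = 1) : ∃ v, ⟪v, ν⟫ = 1 ∧ ∀ ξ, |⟪v, ξ⟫| ≤ F ξ := by
  have hν0 : ν ≠ 0 := by rintro rfl; simp [hF.map_zero] at hν
  obtain ⟨g, hg, hgF⟩ := exists_extension_of_le_sublinear
    (LinearPMap.mkSpanSingleton ν (1 : ℝ) hν0) F
    (fun c hc x => by rw [hF.homog, abs_of_pos hc]) hF.add_le (by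
      rintro ⟨x, hx⟩
      obtain ⟨c, rfl⟩ := Submodule.mem_span_singleton.1 hx
      have h : (LinearPMap.mkSpanSingleton ν (1 : ℝ) hν0) ⟨c • ν, hx⟩ = c • (1 : ℝ) :=
        LinearPMap.mkSpanSingleton'_apply _ _ _ _ _
      rw [h, hF.homog, hν]
      simpa using le_abs_self c)
  let v := (InnerProductSpace.toDual ℝ (EuclideanSpace ℝ (Fin n))).symm
    (LinearMap.toContinuousLinearMap g)
  have hv : ∀ ξ, ⟪v, ξ⟫ = g ξ := fun ξ => by
    simp [v, InnerProductSpace.toDual_symm_apply]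
  refine ⟨v, ?_, fun ξ => ?_⟩
  · have h1 := hg ⟨ν, Submodule.mem_span_singleton_self ν⟩
    rw [hv]
    refine h1.trans ?_
    exact LinearPMap.mkSpanSingleton_apply ℝ ℝ hν0 1
  · rw [hv, abs_le']
    refine ⟨hgF ξ, ?_⟩
    rw [← _root_.map_neg, ← hF.even]
    exact hgF _

lemma bddAbove_wulff_radii (hF : IsMinkowskiNorm F) (hn : 1 ≤ n)
    {Ω : Set (EuclideanSpace ℝ (Fin n))} (hbd : Bornology.IsBounded Ω) :
    BddAbove {r : ℝ | 0 ≤ r ∧ ∃ x₀ : EuclideanSpace ℝ (Fin n),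
      {x : EuclideanSpace ℝ (Fin n) | dualNorm F (x - x₀) ≤ r} ⊆ closure Ω} := by
  obtain ⟨m, hm, hmF⟩ := hF.exists_pos_mul_norm_le
  obtain ⟨C, hC⟩ := Metric.isBounded_iff.1 hbd.closure
  refine ⟨C / m, ?_⟩
  rintro r ⟨hr, x₀, hx₀⟩
  let e : EuclideanSpace ℝ (Fin n) := EuclideanSpace.single ⟨0, hn⟩ 1
  have he : ‖e‖ = 1 := by simp [e]
  have hmem : ∀ s : ℝ, |s| ≤ m * r → x₀ + s • e ∈ closure Ω := fun s hs => hx₀ <| by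
    have h := dualNorm_le_norm_div hF hm hmF (s • e)
    rw [norm_smul, he, mul_one, Real.norm_eq_abs] at h
    simp only [Set.mem_ofPred_eq, add_sub_cancel_left]
    exact h.trans ((div_le_iff₀' hm).2 hs)
  have h := hC (hmem (m * r) (by rw [abs_of_nonneg (by positivity)]))
    (hmem 0 (by simpa using mul_nonneg hm.le hr))
  rw [dist_eq_norm] at h
  simp only [zero_smul, add_zero, add_sub_cancel_left, norm_smul, he, Real.norm_eq_abs,
    mul_one, abs_of_nonneg (mul_nonneg hm.le hr)] at h
  rw [le_div_iff₀ hm]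
  linarith

/-- Finitely many supporting half-spaces of a convex set already see its inscribed radius,
up to an arbitrarily small error. -/
lemma exists_finite_halfspaces (hF : IsMinkowskiNorm F) (hn : 1 ≤ n)
    {Ω : Set (EuclideanSpace ℝ (Fin n))} (hbd : Bornology.IsBounded Ω) (hne : Ω.Nonempty)
    (hconv : Convex ℝ Ω) {R : ℝ} (hR0 : 0 ≤ R) (hR : inscribedRadius F Ω < R) :
    ∃ (N : ℕ) (ν : Fin N → EuclideanSpace ℝ (Fin n)) (h : Fin N → ℝ), (∀ i, F (ν i) = 1) ∧
      (∀ i, ∀ x ∈ Ω, 0 < h i - ⟪ν i, x⟫) ∧ ∀ x ∈ Ω, ∃ i, h i - ⟪ν i, x⟫ ≤ R := by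
  have hex : ∀ x : EuclideanSpace ℝ (Fin n), ∃ (ν : EuclideanSpace ℝ (Fin n)) (h : ℝ), F ν = 1 ∧
      (∀ z ∈ Ω, 0 < h - ⟪ν, z⟫) ∧ h - ⟪ν, x⟫ < R := fun x => by
    have hnot : ¬ {y : EuclideanSpace ℝ (Fin n) | dualNorm F (y - x) ≤ R} ⊆ closure Ω := fun hsub =>
      absurd (le_csSup (bddAbove_wulff_radii hF hn hbd) ⟨hR0, x, hsub⟩) (not_le.2 hR)
    obtain ⟨y, hy, hyΩ⟩ := Set.not_subset.1 hnot
    obtain ⟨g, s, hgs, hsy⟩ := geometric_hahn_banach_closed_point hconv.closure isClosed_closure hyΩ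
    let η := (InnerProductSpace.toDual ℝ (EuclideanSpace ℝ (Fin n))).symm g
    have hη : ∀ z, ⟪η, z⟫ = g z := fun z => InnerProductSpace.toDual_symm_apply
    have hη0 : η ≠ 0 := by
      intro h0
      obtain ⟨z, hz⟩ := hne
      have h1 := (hgs z (subset_closure hz)).trans hsy
      rw [← hη, ← hη, h0] at h1
      simp at h1
    have hFη : 0 < F η := hF.pos η hη0
    refine ⟨(F η)⁻¹ • η, (F η)⁻¹ * s, ?_, fun z hz => ?_, ?_⟩
    · rw [hF.homog, abs_of_pos (inv_pos.2 hFη), inv_mul_cancel₀ hFη.ne']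
    · rw [real_inner_smul_left, hη, ← mul_sub]
      exact mul_pos (inv_pos.2 hFη) (sub_pos.2 (hgs z (subset_closure hz)))
    · rw [real_inner_smul_left, hη, ← mul_sub, inv_mul_lt_iff₀ hFη]
      have h1 := inner_le_dualNorm_mul hF (y - x) η
      rw [real_inner_comm, inner_sub_right, hη, hη] at h1
      have h2 : dualNorm F (y - x) * F η ≤ R * F η := by gcongr; exact hy
      linarith
  choose ν h hν hpos hlt using hex
  obtain ⟨T, -, hT⟩ := hbd.isCompact_closure.elim_nhds_subcover
    (fun x => {y | h x - ⟪ν x, y⟫ < R})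
    (fun x _ => (isOpen_lt (by fun_prop) continuous_const).mem_nhds (hlt x))
  refine ⟨T.card, fun i => ν (T.equivFin.symm i), fun i => h (T.equivFin.symm i),
    fun i => hν _, fun i => hpos _, fun x hx => ?_⟩
  obtain ⟨y, hyT, hy⟩ := Set.mem_iUnion₂.1 (hT (subset_closure hx))
  exact ⟨T.equivFin ⟨y, hyT⟩, by simpa using le_of_lt (show h y - ⟪ν y, x⟫ < R from hy)⟩

/-- A continuous function positive on the compact support of `u` has a uniform positive margin there. -/
lemma exists_pos_forall_le_eq_zero {E : Type*} [TopologicalSpace E] {u a : E → ℝ}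
    (hsupp : HasCompactSupport u) (ha : Continuous a) (hpos : ∀ x ∈ tsupport u, 0 < a x) :
    ∃ δ > 0, ∀ x, a x ≤ δ → u x = 0 := by
  obtain ⟨δ, hδ, h⟩ := hsupp.isCompact.exists_forall_le' ha.continuousOn hpos
  refine ⟨δ / 2, by positivity, fun x hx => ?_⟩
  by_contra hux
  have := h x (subset_tsupport u hux)
  linarith

lemma setLIntegral_sq_le_of_inscribedRadius_lt (hn : 1 ≤ n)
    {Ω : Set (EuclideanSpace ℝ (Fin n))} (hne : Ω.Nonempty) (hbd : Bornology.IsBounded Ω)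
    (hconv : Convex ℝ Ω) (hF : IsMinkowskiNorm F) {R : ℝ} (hR0 : 0 < R)
    (hR : inscribedRadius F Ω < R) {u : EuclideanSpace ℝ (Fin n) → ℝ} (hu : ContDiff ℝ 1 u)
    (hsupp : HasCompactSupport u) (hsuppΩ : tsupport u ⊆ Ω) :
    ∫⁻ x in Ω, ENNReal.ofReal ((π / (2 * R)) ^ 2 * u x ^ 2) ≤
      ∫⁻ x, ENNReal.ofReal (F (gradient u x) ^ 2) := by
  obtain ⟨N, ν, h, hν, hpos, hmin⟩ := exists_finite_halfspaces hF hn hbd hne hconv hR0.le hR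
  let a : Fin N → EuclideanSpace ℝ (Fin n) → ℝ := fun i x => h i - ⟪ν i, x⟫
  have hac : ∀ i, Continuous (a i) := fun i => by simp only [a]; fun_prop
  have hD := measurableSet_minCell (fun i => (hac i).measurable) R
  have hcell : ∀ i, ∫⁻ x in minCell a R i, ENNReal.ofReal ((π / (2 * R)) ^ 2 * u x ^ 2) ≤
      ∫⁻ x in minCell a R i, ENNReal.ofReal (F (gradient u x) ^ 2) := fun i => by
    obtain ⟨v, hv1, hvF⟩ := hF.exists_inner_eq (hν i)
    have hshift : ∀ j x (t : ℝ), a j (x + t • (-v)) = a j x + t * ⟪v, ν j⟫ := fun j x t => by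
      simp only [a, inner_add_right, real_inner_smul_right, inner_neg_right,
        real_inner_comm (ν j) v]
      ring
    have haw : ∀ x (t : ℝ), a i (x + t • (-v)) = a i x + t := fun x t => by
      rw [hshift, hv1, mul_one]
    obtain ⟨δ, hδ, hu0⟩ := exists_pos_forall_le_eq_zero hsupp (hac i)
      fun x hx => hpos i x (hsuppΩ hx)
    refine (setLIntegral_sq_le_of_fibred volume hu (hac i).measurable haw hδ hR0 hu0 (hD i)
      (fun x hx => hx.1) fun x hx t ht hat => ?_).trans (lintegral_mono fun x => ?_)
    · have hj : ∀ j, t ≤ t * ⟪v, ν j⟫ := fun j => by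
        have h1 := (abs_le.1 (hvF (ν j))).2
        rw [hν] at h1
        nlinarith
      refine ⟨?_, fun j => ?_⟩
      · rw [haw]
        exact ⟨hat, by linarith [hx.1.2]⟩
      · rw [haw, hshift]
        exact ⟨by linarith [hj j, (hx.2 j).1], fun hji => by linarith [hj j, (hx.2 j).2 hji]⟩
    · have h1 : fderiv ℝ u x (-v) = -⟪v, gradient u x⟫ := by
        rw [_root_.map_neg, real_inner_comm, gradient, InnerProductSpace.toDual_symm_apply]
      refine ENNReal.ofReal_le_ofReal ?_
      rw [h1, neg_sq, ← sq_abs]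
      exact pow_le_pow_left₀ (abs_nonneg _) (hvF _) 2
  calc ∫⁻ x in Ω, ENNReal.ofReal ((π / (2 * R)) ^ 2 * u x ^ 2)
      ≤ ∫⁻ x in ⋃ i, minCell a R i, ENNReal.ofReal ((π / (2 * R)) ^ 2 * u x ^ 2) :=
        lintegral_mono_set fun x hx => Set.mem_iUnion.2
          (exists_mem_minCell (fun i => hpos i x hx) (hmin x hx))
    _ = ∑' i, ∫⁻ x in minCell a R i, ENNReal.ofReal ((π / (2 * R)) ^ 2 * u x ^ 2) :=
        lintegral_iUnion hD (pairwise_disjoint_minCell a R) _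
    _ ≤ ∑' i, ∫⁻ x in minCell a R i, ENNReal.ofReal (F (gradient u x) ^ 2) :=
        ENNReal.tsum_le_tsum hcell
    _ = ∫⁻ x in ⋃ i, minCell a R i, ENNReal.ofReal (F (gradient u x) ^ 2) :=
        (lintegral_iUnion hD (pairwise_disjoint_minCell a R) _).symm
    _ ≤ _ := setLIntegral_le_lintegral _ _

lemma integral_sq_le_of_inscribedRadius_lt (hn : 1 ≤ n)
    {Ω : Set (EuclideanSpace ℝ (Fin n))} (hne : Ω.Nonempty) (hbd : Bornology.IsBounded Ω)
    (hconv : Convex ℝ Ω) (hF : IsMinkowskiNorm F) {R : ℝ} (hR0 : 0 < R)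
    (hR : inscribedRadius F Ω < R) {u : EuclideanSpace ℝ (Fin n) → ℝ} (hu : ContDiff ℝ 1 u)
    (hsupp : HasCompactSupport u) (hsuppΩ : tsupport u ⊆ Ω) :
    (π / (2 * R)) ^ 2 * ∫ x in Ω, u x ^ 2 ≤ ∫ x in Ω, F (gradient u x) ^ 2 := by
  have hgrad0 : ∀ x, x ∉ tsupport u → gradient u x = 0 := fun x hx => by
    have h1 : fderiv ℝ u x = 0 :=
      Function.notMem_support.1 fun h => hx (support_fderiv_subset ℝ h)
    rw [gradient, h1, _root_.map_zero]
  have hgc : Continuous (gradient u) :=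
    (LinearIsometryEquiv.continuous _).comp (hu.continuous_fderiv (by norm_num))
  have hFc : Continuous fun x => F (gradient u x) ^ 2 := (hF.continuous.comp hgc).pow 2
  have hFs : HasCompactSupport fun x => F (gradient u x) ^ 2 :=
    HasCompactSupport.intro hsupp.isCompact fun x hx => by
      simp [hgrad0 x hx, hF.map_zero]
  have huc : Continuous fun x => (π / (2 * R)) ^ 2 * u x ^ 2 :=
    continuous_const.mul (hu.continuous.pow 2)
  have hus : HasCompactSupport fun x => (π / (2 * R)) ^ 2 * u x ^ 2 :=
    HasCompactSupport.intro hsupp.isCompact fun x hx => by simp [image_eq_zero_of_notMem_tsupport hx]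
  have hFi := hFc.integrable_of_hasCompactSupport (μ := volume) hFs
  have hui := huc.integrable_of_hasCompactSupport (μ := volume) hus
  have hwhole : ∫ x in Ω, F (gradient u x) ^ 2 = ∫ x, F (gradient u x) ^ 2 :=
    setIntegral_eq_integral_of_forall_compl_eq_zero fun x hx => by
      simp [hgrad0 x fun h => hx (hsuppΩ h), hF.map_zero]
  rw [hwhole, ← integral_const_mul, ← ENNReal.ofReal_le_ofReal_iff
    (integral_nonneg fun x => sq_nonneg _), ofReal_integral_eq_lintegral_ofReal hui.integrableOn
    (Filter.Eventually.of_forall fun x => by positivity), ofReal_integral_eq_lintegral_ofReal hFi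
    (Filter.Eventually.of_forall fun x => sq_nonneg _)]
  exact setLIntegral_sq_le_of_inscribedRadius_lt hn hne hbd hconv hF hR0 hR hu hsupp hsuppΩ

end Minkowski

/-- Lower bound `π²/(4 i_F²)` for the first Dirichlet eigenvalue of the
Finsler–Laplacian on a convex domain, as a Poincaré-type inequality. -/
theorem anisotropic_dirichlet_eigenvalue_bound {n : ℕ} (hn : 1 ≤ n)
    (Ω : Set (EuclideanSpace ℝ (Fin n))) (hne : Ω.Nonempty)
    (hbd : Bornology.IsBounded Ω) (hop : IsOpen Ω) (hconv : Convex ℝ Ω)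
    (hsb : HasSmoothBoundary Ω)
    (F : EuclideanSpace ℝ (Fin n) → ℝ) (hF : IsMinkowskiNorm F)
    (iF : ℝ) (hiF : iF = inscribedRadius F Ω)
    (u : EuclideanSpace ℝ (Fin n) → ℝ) (hu : ContDiff ℝ 1 u)
    (hsupp : HasCompactSupport u) (hsuppΩ : tsupport u ⊆ Ω) :
    (π ^ 2 / (4 * iF ^ 2)) * ∫ x in Ω, (u x) ^ 2 ≤ ∫ x in Ω, F (gradient u x) ^ 2 := by
  have hi0 : 0 ≤ iF := by
    rw [hiF]
    exact Real.sSup_nonneg fun r hr => hr.1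
  rcases hi0.eq_or_lt with h0 | h0
  · rw [← h0]
    simpa using integral_nonneg fun x => sq_nonneg (F (gradient u x))
  have hcont : ContinuousAt (fun R : ℝ => (π / (2 * R)) ^ 2 * ∫ x in Ω, (u x) ^ 2) iF := by
    have : 2 * iF ≠ 0 := by positivity
    fun_prop (disch := assumption)
  have hlim := hcont.tendsto.mono_left (nhdsWithin_le_nhds (s := Set.Ioi iF))
  have hle := le_of_tendsto hlim (Filter.eventually_of_mem self_mem_nhdsWithin fun R hR =>
    integral_sq_le_of_inscribedRadius_lt hn hne hbd hconv hF (h0.trans hR) (hiF ▸ hR) hu hsupp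
      hsuppΩ)
  calc π ^ 2 / (4 * iF ^ 2) * ∫ x in Ω, u x ^ 2
      = (π / (2 * iF)) ^ 2 * ∫ x in Ω, u x ^ 2 := by rw [div_pow, mul_pow]; norm_num
    _ ≤ _ := hle
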